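/- Let X be a finite-dimensional right H-module. For f ∈ C^n_H(B) define (Ψⁿ f)(ω ⊗ (T₀⊗b₀) ⊗ ⋯ ⊗ (Tₙ⊗bₙ)) = f(ω_(0) ⊗ b₀ ⊗ ⋯ ⊗ bₙ) · Tr(π_X(S^{-1}(ω_(1))) T₀ ⋯ Tₙ), where Tr is the non-normalized trace on End(X). Then Ψⁿ f is H-invariant, so Ψⁿ is a well-defined linear map C^n_H(B) → C^n_H(End(X)⊗B), and the family (Ψⁿ)_{n≥0} commutes with the operators t_n, d^n_i, s^n_i (i.e. is a morphism of cocyclic objects), hence induces homomorphisms [Ψⁿ] : HC^n_H(B) → HC^n_H(End(X)⊗B). -/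

import Mathlib

open scoped TensorProduct

noncomputable section

/-- A Hopf `ℂ`-algebra with invertible antipode, together with a chosen finite
(Sweedler) representation of the comultiplication: `Δ ω = ∑_{p ∈ Δl ω} p.1 ⊗ p.2`. -/
structure HopfData (H : Type) [Ring H] [HopfAlgebra ℂ H] where
  /-- the inverse of the antipode -/
  Sinv : H →ₗ[ℂ] H
  Sinv_antipode : ∀ ω : H, Sinv (HopfAlgebra.antipode (R := ℂ) ω) = ω
  antipode_Sinv : ∀ ω : H, HopfAlgebra.antipode (R := ℂ) (Sinv ω) = ω
  /-- a chosen list representation of the comultiplication -/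
  Δl : H → List (H × H)
  Δl_repr : ∀ ω : H,
    (Coalgebra.comul (R := ℂ) ω : H ⊗[ℂ] H) = ((Δl ω).map fun p => p.1 ⊗ₜ[ℂ] p.2).sum

variable {H : Type} [Ring H] [HopfAlgebra ℂ H]

/-- the counit, as a `ℂ`-valued function -/
def epsi (ω : H) : ℂ := Coalgebra.counit (R := ℂ) ω

/-- Iterated Sweedler decomposition: `sw n ω` represents
`Δⁿ ω = ∑_v v 0 ⊗ ⋯ ⊗ v n`, where `Δⁿ = (ι ⊗ Δ) Δ^{n-1}`. -/
def HopfData.sw (D : HopfData H) : (n : ℕ) → H → List (Fin (n + 1) → H)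
  | 0, ω => [fun _ => ω]
  | n + 1, ω =>
    (D.sw n ω).flatMap fun v =>
      (D.Δl (v (Fin.last n))).map fun p =>
        Fin.snoc (Function.update v (Fin.last n) p.1) p.2

/-- A right `H`-module structure (over `ℂ`), recorded as the antihomomorphism
`act : H → End(B)`, so `act ω b` stands for `b ◁ ω`. -/
structure RAct (H : Type) [Ring H] [HopfAlgebra ℂ H] (B : Type) [AddCommGroup B]
    [Module ℂ B] where
  act : H →ₗ[ℂ] B →ₗ[ℂ] B
  act_one : act 1 = LinearMap.id
  act_mul : ∀ ω η : H, act (ω * η) = (act η) ∘ₗ (act ω)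

/-- A unital right `H`-module algebra structure on `B`:
`(b₁ b₂) ◁ ω = ∑ (b₁ ◁ ω₍₀₎)(b₂ ◁ ω₍₁₎)` and `1 ◁ ω = ε(ω) 1`. -/
structure MAlg (D : HopfData H) (B : Type) [Ring B] [Algebra ℂ B] extends RAct H B where
  act_mul_mul : ∀ (ω : H) (b₁ b₂ : B),
    act ω (b₁ * b₂) = ((D.Δl ω).map fun p => act p.1 b₁ * act p.2 b₂).sum
  act_algOne : ∀ ω : H, act ω (1 : B) = epsi ω • (1 : B)


/-- the action as a plain function: `fn ω b = b ◁ ω` -/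
def RAct.fn {H : Type} [Ring H] [HopfAlgebra ℂ H] {B : Type} [AddCommGroup B] [Module ℂ B]
    (A : RAct H B) : H → B → B := fun ω x => A.act ω x

/-- the action of a module algebra as a plain function -/
def MAlg.fn {H : Type} [Ring H] [HopfAlgebra ℂ H] {B : Type} [Ring B] [Algebra ℂ B]
    {D : HopfData H} (A : MAlg D B) : H → B → B := A.toRAct.fn

/-- The space of `ℂ`-valued functions of one `H`-variable and `n+1` `B`-variables;
(multi)linear such functions correspond to linear functionals on `H ⊗ B^{⊗(n+1)}`. -/
abbrev Raw (H B : Type) (n : ℕ) := H → (Fin (n + 1) → B) → ℂ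

section Raw

variable {H : Type} [Ring H] [HopfAlgebra ℂ H] {B : Type} [Ring B] [Algebra ℂ B] {n : ℕ}

/-- `f` is linear in the `H`-variable and in each `B`-variable separately, i.e. `f`
is (the restriction of) a linear functional on `H ⊗ B^{⊗(n+1)}`. -/
def IsML (f : Raw H B n) : Prop :=
  (∀ ω η b, f (ω + η) b = f ω b + f η b) ∧
  (∀ (c : ℂ) ω b, f (c • ω) b = c * f ω b) ∧
  (∀ ω b (i : Fin (n + 1)) (x y : B),
    f ω (Function.update b i (x + y)) =
      f ω (Function.update b i x) + f ω (Function.update b i y)) ∧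
  (∀ ω b (i : Fin (n + 1)) (c : ℂ) (x : B),
    f ω (Function.update b i (c • x)) = c * f ω (Function.update b i x))

/-- `H`-invariance of the functional `f` on `H ⊗ B^{⊗(n+1)}`:
`(ω ▷ f)(η ⊗ b₀ ⊗ ⋯ ⊗ bₙ) = f(S⁻¹(ω₍₀₎) η ω₍₁₎ ⊗ b₀ ◁ ω₍₂₎ ⊗ ⋯ ⊗ bₙ ◁ ω₍ₙ₊₂₎)`
equals `ε(ω) f(η ⊗ b₀ ⊗ ⋯ ⊗ bₙ)`. -/
def IsInv (D : HopfData H) (act : H → B → B) (f : Raw H B n) : Prop :=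
  ∀ (ω η : H) (b : Fin (n + 1) → B),
    ((D.sw (n + 2) ω).map fun v =>
        f (D.Sinv (v 0) * η * v 1) fun i => act (v i.succ.succ) (b i)).sum
      = epsi ω * f η b

/-- membership in the equivariant cochain space `C^n_H(B)` -/
def InC (D : HopfData H) (act : H → B → B) (f : Raw H B n) : Prop :=
  IsML f ∧ IsInv D act f

/-- the cyclic operator
`(tₙ f)(ω ⊗ b₀ ⊗ ⋯ ⊗ bₙ) = f(ω₍₀₎ ⊗ bₙ ◁ ω₍₁₎ ⊗ b₀ ⊗ ⋯ ⊗ b_{n-1})` -/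
def tRaw (D : HopfData H) (act : H → B → B) (f : Raw H B n) : Raw H B n :=
  fun ω b =>
    ((D.Δl ω).map fun p =>
      f p.1 (Fin.cons (act p.2 (b (Fin.last n))) fun i : Fin n => b i.castSucc)).sum

/-- merging the `i`-th and `(i+1)`-st entries of a `(n+2)`-tuple by multiplication -/
def contract (i : Fin (n + 1)) (b : Fin (n + 2) → B) : Fin (n + 1) → B :=
  fun j =>
    if (j : ℕ) < (i : ℕ) then b j.castSucc
    else if (j : ℕ) = (i : ℕ) then b j.castSucc * b j.succ
    else b j.succ

/-- the coface operators `dⁿᵢ : C^{n} → C^{n+1}` (`i < n+1` multiplies adjacent entries;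
the last one is `d_{n+1} = t ∘ d₀`) -/
def dRaw (D : HopfData H) (act : H → B → B) (i : Fin (n + 2)) (f : Raw H B n) :
    Raw H B (n + 1) :=
  if h : (i : ℕ) < n + 1 then fun ω b => f ω (contract ⟨i, h⟩ b)
  else tRaw D act fun ω b => f ω (contract 0 b)

/-- the codegeneracy operators `sⁿᵢ : C^{n+1} → C^n`, inserting a `1` after the `i`-th entry -/
def sRaw (i : Fin (n + 1)) (f : Raw H B (n + 1)) : Raw H B n :=
  fun ω b => f ω (Fin.insertNth i.succ 1 b)

/-- the Hochschild coboundary `b = ∑ (-1)ⁱ dᵢ` -/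
def bRaw (D : HopfData H) (act : H → B → B) (f : Raw H B n) : Raw H B (n + 1) :=
  fun ω b => ∑ i : Fin (n + 2), ((-1 : ℂ) ^ (i : ℕ)) * dRaw D act i f ω b

/-- cyclicity: `λ f = (-1)ⁿ tₙ f = f` -/
def IsCyc (D : HopfData H) (act : H → B → B) (f : Raw H B n) : Prop :=
  ∀ ω b, ((-1 : ℂ) ^ n) * tRaw D act f ω b = f ω b

/-- an `n`-cocycle of the cyclic complex `(Ker(1-λ), b)` computing `HC^n_H(B)` -/
def IsCocycle (D : HopfData H) (act : H → B → B) (f : Raw H B n) : Prop :=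
  InC D act f ∧ IsCyc D act f ∧ ∀ ω b, bRaw D act f ω b = 0

end Raw

section Mat

variable {H : Type} [Ring H] [HopfAlgebra ℂ H]

/-- A finite-dimensional right `H`-module, presented as a matrix antirepresentation
`π : H → Matrix ι ι ℂ` (so `x ◁ ω` is the row vector `x · π(ω)`). -/
structure MRep (H : Type) [Ring H] [HopfAlgebra ℂ H] (ι : Type) [Fintype ι]
    [DecidableEq ι] where
  π : H →ₗ[ℂ] Matrix ι ι ℂ
  π_one : π 1 = 1
  π_mul : ∀ ω η : H, π (ω * η) = π η * π ω

variable {B : Type} [Ring B] [Algebra ℂ B]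
variable {ι κ : Type} [Fintype ι] [DecidableEq ι] [Fintype κ] [DecidableEq κ]

/-- The right `H`-action on `Hom(X, X') ⊗ B` (realized as rectangular matrices over `B`):
`(T ⊗ b) ◀ ω = π'(ω₍₀₎) T π(S⁻¹(ω₍₂₎)) ⊗ b ◁ ω₍₁₎`. -/
def matActR (D : HopfData H) (P : MRep H ι) (P' : MRep H κ) (A : RAct H B) :
    H → Matrix κ ι B → Matrix κ ι B :=
  fun ω M =>
    ((D.sw 2 ω).map fun v =>
      ((P'.π (v 0)).map (algebraMap ℂ B)) *
        (M.map fun x => A.act (v 1) x) *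
          ((P.π (D.Sinv (v 2))).map (algebraMap ℂ B))).sum

/-- the right `H`-action on `End(X) ⊗ B`, realized as `Matrix ι ι B` -/
def matAct (D : HopfData H) (P : MRep H ι) (A : RAct H B) :
    H → Matrix ι ι B → Matrix ι ι B :=
  matActR D P P A

/-- The map `Ψⁿ : C^n_H(B) → C^n_H(End(X) ⊗ B)`,
`(Ψⁿ f)(ω ⊗ (T₀⊗b₀) ⊗ ⋯ ⊗ (Tₙ⊗bₙ)) = f(ω₍₀₎ ⊗ b₀ ⊗ ⋯ ⊗ bₙ) Tr(π(S⁻¹(ω₍₁₎)) T₀ ⋯ Tₙ)`,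
written out on matrices over `B`. -/
def PsiRaw (D : HopfData H) (P : MRep H ι) {n : ℕ} (f : Raw H B n) :
    Raw H (Matrix ι ι B) n :=
  fun ω M =>
    ((D.Δl ω).map fun p =>
      ∑ k : Fin (n + 2) → ι,
        (P.π (D.Sinv p.2)) (k (Fin.last (n + 1))) (k 0) *
          f p.1 fun i => M i (k i.castSucc) (k i.succ)).sum

/-- the right `H`-action on `X ⊗ B` (tensor product action), `X` realized as row
vectors with matrix antirepresentation `P` -/
def ractV (D : HopfData H) (P : MRep H ι) (A : RAct H B) (ω : H) (v : ι → B) : ι → B :=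
  fun j => ((D.Δl ω).map fun p => ∑ i, (P.π p.1) i j • A.act p.2 (v i)).sum

/-- membership in `R(H)`, the `H`-invariant linear functionals on `H` (with the
adjoint action `η ◁ ω = S⁻¹(ω₍₀₎) η ω₍₁₎`) -/
def IsRH (D : HopfData H) (F : H → ℂ) : Prop :=
  (∀ ω η : H, F (ω + η) = F ω + F η) ∧
  (∀ (c : ℂ) (ω : H), F (c • ω) = c * F ω) ∧
  (∀ ω η : H, ((D.Δl ω).map fun p => F (D.Sinv p.1 * η * p.2)).sum = epsi ω * F η)

end Mat

set_option linter.unusedSectionVars false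

attribute [fun_prop] IsLinearMap
section
variable {R M N P : Type*} [CommSemiring R] [AddCommMonoid M] [AddCommMonoid N] [AddCommMonoid P] [Module R M] [Module R N] [Module R P]
@[fun_prop] theorem Lin.id : IsLinearMap R (fun x : M => x) := ⟨fun _ _ => rfl, fun _ _ => rfl⟩
@[fun_prop] theorem Lin.comp {f : N → P} {g : M → N} (hf : IsLinearMap R f) (hg : IsLinearMap R g) : IsLinearMap R (fun x => f (g x)) := ⟨fun _ _ => by rw [hg.1, hf.1], fun _ _ => by rw [hg.2, hf.2]⟩
@[fun_prop] theorem Lin.lm (f : M →ₗ[R] N) : IsLinearMap R (fun x => f x) := f.isLinear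
@[fun_prop] theorem Lin.lm2 {f : M → N →ₗ[R] P} (n : N) (hf : IsLinearMap R f) : IsLinearMap R (fun x => f x n) := ⟨fun _ _ => by simp [hf.1], fun _ _ => by simp [hf.2]⟩
@[fun_prop] theorem Lin.mul1 {A} [Semiring A] [Algebra R A] {f : M → A} (a : A) (hf : IsLinearMap R f) : IsLinearMap R (fun x => f x * a) := ⟨fun _ _ => by simp [hf.1, add_mul], fun _ _ => by simp [hf.2]⟩
@[fun_prop] theorem Lin.mul2 {A} [Semiring A] [Algebra R A] {f : M → A} (a : A) (hf : IsLinearMap R f) : IsLinearMap R (fun x => a * f x) := ⟨fun _ _ => by simp [hf.1, mul_add], fun _ _ => by simp [hf.2]⟩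
@[fun_prop] theorem Lin.sum {ι} {s : Finset ι} {f : ι → M → N} (hf : ∀ i, IsLinearMap R (f i)) : IsLinearMap R (fun x => ∑ i ∈ s, f i x) := ⟨fun _ _ => by simp [fun i => (hf i).1, Finset.sum_add_distrib], fun _ _ => by simp [fun i => (hf i).2, Finset.smul_sum]⟩
@[fun_prop] theorem Lin.smul1 {f : M → R} (a : N) (hf : IsLinearMap R f) :
    IsLinearMap R (fun x => f x • a) :=
  ⟨fun _ _ => by simp [hf.1, add_smul], fun _ _ => by simp [hf.2, mul_smul]⟩
@[fun_prop] theorem Lin.smul2 {f : M → N} (a : R) (hf : IsLinearMap R f) :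
    IsLinearMap R (fun x => a • f x) :=
  ⟨fun _ _ => by simp [hf.1], fun _ _ => by simp [hf.2, smul_comm a]⟩
@[fun_prop] theorem Lin.tmul1 {f : M → N} (a : P) (hf : IsLinearMap R f) :
    IsLinearMap R (fun x => f x ⊗ₜ[R] a) :=
  ⟨fun _ _ => by simp [hf.1, TensorProduct.add_tmul], fun _ _ => by simp [hf.2, TensorProduct.smul_tmul']⟩
@[fun_prop] theorem Lin.tmul2 {f : M → N} (a : P) (hf : IsLinearMap R f) :
    IsLinearMap R (fun x => a ⊗ₜ[R] f x) :=
  ⟨fun _ _ => by simp [hf.1, TensorProduct.tmul_add], fun _ _ => by simp [hf.2, TensorProduct.tmul_smul]⟩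
end

set_option linter.unusedSectionVars false
section SD
variable {H : Type} [Ring H] [HopfAlgebra ℂ H] (D : HopfData H)
variable {V W M : Type*} [AddCommGroup V] [Module ℂ V] [AddCommGroup W] [Module ℂ W]
  [AddCommGroup M] [Module ℂ M]

/-- Sweedler sum `∑ g ω₍₀₎ ω₍₁₎`. -/
def HopfData.sd (ω : H) (g : H → H → V) : V := ((D.Δl ω).map fun p => g p.1 p.2).sum

theorem sd_add (ω : H) (g h : H → H → V) :
    D.sd ω (fun x y => g x y + h x y) = D.sd ω g + D.sd ω h := by
  simp [HopfData.sd, List.sum_map_add]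

theorem sd_smul (ω : H) (c : ℂ) (g : H → H → V) :
    D.sd ω (fun x y => c • g x y) = c • D.sd ω g := by
  simp [HopfData.sd, List.smul_sum, Function.comp_def]

theorem sd_mapL (ω : H) (L : V →ₗ[ℂ] W) (g : H → H → V) :
    L (D.sd ω g) = D.sd ω (fun x y => L (g x y)) := by
  simp [HopfData.sd, map_list_sum, Function.comp_def]

theorem sd_map {L : V → W} (hL : IsLinearMap ℂ L) (ω : H) (g : H → H → V) :
    L (D.sd ω g) = D.sd ω (fun x y => L (g x y)) := sd_mapL D ω hL.mk' g

theorem sd_sum {κ : Type*} (s : Finset κ) (ω : H) (g : κ → H → H → V) :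
    D.sd ω (fun x y => ∑ k ∈ s, g k x y) = ∑ k ∈ s, D.sd ω (g k) := by
  classical
  induction s using Finset.induction_on with
  | empty => simp [HopfData.sd]
  | insert a s ha ih => simp [Finset.sum_insert ha, sd_add, ih]

theorem sd_mul (ω : H) (c : ℂ) (g : H → H → ℂ) :
    D.sd ω (fun x y => c * g x y) = c * D.sd ω g := sd_smul D ω c g

@[fun_prop] theorem Lin.sd2 (ω : H) {g : M → H → H → V}
    (hg : ∀ x y, IsLinearMap ℂ (fun m => g m x y)) :
    IsLinearMap ℂ (fun m => D.sd ω (g m)) := by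
  constructor
  · intro a b; rw [← sd_add]; congr; ext x y; exact (hg x y).1 a b
  · intro c a; rw [← sd_smul]; congr; ext x y; exact (hg x y).2 c a

theorem sd_lift (G : H →ₗ[ℂ] H →ₗ[ℂ] V) (ω : H) :
    D.sd ω (fun x y => G x y) = TensorProduct.lift G (Coalgebra.comul (R := ℂ) ω) := by
  rw [D.Δl_repr]; simp [HopfData.sd, map_list_sum, Function.comp_def]

/-- bundled bilinear map -/
def mkBil (g : H → H → V) (h1 : ∀ y, IsLinearMap ℂ (fun x => g x y))
    (h2 : ∀ x, IsLinearMap ℂ (fun y => g x y)) : H →ₗ[ℂ] H →ₗ[ℂ] V :=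
  LinearMap.mk₂ ℂ g (fun a b y => (h1 y).1 a b) (fun c a y => (h1 y).2 c a)
    (fun x a b => (h2 x).1 a b) (fun c x a => (h2 x).2 c a)

theorem sd_lift' (g : H → H → V) (h1 : ∀ y, IsLinearMap ℂ (fun x => g x y))
    (h2 : ∀ x, IsLinearMap ℂ (fun y => g x y)) (ω : H) :
    D.sd ω g = TensorProduct.lift (mkBil g h1 h2) (Coalgebra.comul (R := ℂ) ω) :=
  sd_lift D (mkBil g h1 h2) ω

@[fun_prop] theorem Lin.sd1 {w : M → H} (hw : IsLinearMap ℂ w) {g : H → H → V}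
    (h1 : ∀ y, IsLinearMap ℂ (fun x => g x y))
    (h2 : ∀ x, IsLinearMap ℂ (fun y => g x y)) :
    IsLinearMap ℂ (fun m => D.sd (w m) g) := by
  have : (fun m => D.sd (w m) g) = fun m =>
      (TensorProduct.lift (mkBil g h1 h2) ∘ₗ Coalgebra.comul (R := ℂ)) (w m) := by
    ext m; exact sd_lift' D g h1 h2 _
  rw [this]
  fun_prop

theorem sd_tmul (ω : H) : D.sd ω (fun x y => x ⊗ₜ[ℂ] y) = Coalgebra.comul (R := ℂ) ω :=
  (D.Δl_repr ω).symm

theorem sd_coassoc (ω : H) (g : H → H → H → V)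
    (h1 : ∀ y z, IsLinearMap ℂ (fun x => g x y z))
    (h2 : ∀ x z, IsLinearMap ℂ (fun y => g x y z))
    (h3 : ∀ x y, IsLinearMap ℂ (fun z => g x y z)) :
    D.sd ω (fun p q => D.sd p (fun x y => g x y q))
      = D.sd ω (fun x r => D.sd r (fun y q => g x y q)) := by
  -- bundled trilinear map
  let G : H →ₗ[ℂ] (H ⊗[ℂ] H) →ₗ[ℂ] V :=
    { toFun := fun x => TensorProduct.lift (mkBil (g x) (h2 x) (h3 x))
      map_add' := fun a b => by
        ext y z; exact (h1 y z).1 a b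
      map_smul' := fun c a => by
        ext y z; exact (h1 y z).2 c a }
  have key := Coalgebra.coassoc_apply (R := ℂ) ω
  have := congrArg (TensorProduct.lift G) key
  rw [← sd_tmul D ω] at this
  simp only [sd_mapL, LinearMap.rTensor_tmul, LinearMap.lTensor_tmul, TensorProduct.lift.tmul] at this
  have ha : IsLinearMap ℂ (fun t => (TensorProduct.lift G) ((TensorProduct.assoc ℂ H H H) t)) :=
    (TensorProduct.lift G ∘ₗ (TensorProduct.assoc ℂ H H H).toLinearMap).isLinear
  rw [sd_map D ha] at this
  simp only [← sd_tmul D] at this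
  simp only [sd_mapL D _ (G _)] at this
  have e : ∀ p q : H, (TensorProduct.lift G) ((TensorProduct.assoc ℂ H H H)
      ((D.sd p fun x y => x ⊗ₜ[ℂ] y) ⊗ₜ[ℂ] q)) = D.sd p fun x y => g x y q := by
    intro p q
    have hl : IsLinearMap ℂ (fun t : H ⊗[ℂ] H => (TensorProduct.lift G)
      ((TensorProduct.assoc ℂ H H H) (t ⊗ₜ[ℂ] q))) := by
      constructor
      · intro a b; simp [TensorProduct.add_tmul]
      · intro a b; simp [← TensorProduct.smul_tmul']
    exact sd_map D hl p _
  simp only [e] at this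
  exact this

theorem sd_counit_left (ω : H) (g : H → V) (hg : IsLinearMap ℂ g) :
    D.sd ω (fun x y => epsi x • g y) = g ω := by
  have h := Coalgebra.rTensor_counit_comul (R := ℂ) ω
  rw [← sd_tmul D ω, sd_mapL] at h
  have := congrArg (TensorProduct.lift
    ((LinearMap.lsmul ℂ V).flip ∘ₗ hg.mk').flip) h
  rw [sd_mapL] at this
  simpa [epsi] using this

theorem sd_counit_right (ω : H) (g : H → V) (hg : IsLinearMap ℂ g) :
    D.sd ω (fun x y => epsi y • g x) = g ω := by
  have h := Coalgebra.lTensor_counit_comul (R := ℂ) ω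
  rw [← sd_tmul D ω, sd_mapL] at h
  have := congrArg (TensorProduct.lift
    ((LinearMap.lsmul ℂ V).flip ∘ₗ hg.mk')) h
  rw [sd_mapL] at this
  simpa [epsi] using this

@[fun_prop] theorem Lin.epsi : IsLinearMap ℂ (fun x : H => _root_.epsi x) :=
  (Coalgebra.counit (R := ℂ) (A := H)).isLinear

local notation "SS" => HopfAlgebra.antipode ℂ (A := H)

theorem sd_S_left (ω : H) : D.sd ω (fun x y => SS x * y) = epsi ω • (1 : H) := by
  have h := HopfAlgebra.mul_antipode_rTensor_comul_apply (R := ℂ) ω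
  rw [← sd_tmul D ω, sd_mapL, sd_mapL] at h
  simpa [epsi, Algebra.algebraMap_eq_smul_one] using h

theorem sd_S_right (ω : H) : D.sd ω (fun x y => x * SS y) = epsi ω • (1 : H) := by
  have h := HopfAlgebra.mul_antipode_lTensor_comul_apply (R := ℂ) ω
  rw [← sd_tmul D ω, sd_mapL, sd_mapL] at h
  simpa [epsi, Algebra.algebraMap_eq_smul_one] using h

theorem Sinv_one : D.Sinv 1 = 1 := by
  rw [← HopfAlgebra.antipode_one (R := ℂ) (A := H), D.Sinv_antipode]
  exact (HopfAlgebra.antipode_one (R := ℂ) (A := H)).symm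

theorem Sinv_mul (a b : H) : D.Sinv (a * b) = D.Sinv b * D.Sinv a := by
  have h : SS (D.Sinv b * D.Sinv a) = a * b := by
    rw [HopfAlgebra.antipode_mul_antidistrib, D.antipode_Sinv, D.antipode_Sinv]
  rw [← h, D.Sinv_antipode]

theorem sd_Sinv_left (ω : H) : D.sd ω (fun x y => D.Sinv y * x) = epsi ω • (1 : H) := by
  have h := congrArg D.Sinv (sd_S_left D ω)
  rw [sd_mapL] at h
  simpa [Sinv_mul, D.Sinv_antipode, Sinv_one] using h

theorem sd_Sinv_right (ω : H) : D.sd ω (fun x y => y * D.Sinv x) = epsi ω • (1 : H) := by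
  have h := congrArg D.Sinv (sd_S_right D ω)
  rw [sd_mapL] at h
  simpa [Sinv_mul, D.Sinv_antipode, Sinv_one] using h

/-- collapse of two adjacent legs -/
theorem sd_collapse (ω : H) (m : H → H → H) (hm1 : ∀ y, IsLinearMap ℂ (fun x => m x y))
    (hm2 : ∀ x, IsLinearMap ℂ (fun y => m x y))
    (hm : ∀ ω, D.sd ω m = epsi ω • (1 : H)) (g : H → H → V)
    (h1 : ∀ y, IsLinearMap ℂ (fun x => g x y))
    (h2 : ∀ x, IsLinearMap ℂ (fun y => g x y)) :
    D.sd ω (fun x r => D.sd r (fun y q => g (m x y) q)) = g 1 ω := by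
  rw [← sd_coassoc D ω (fun x y q => g (m x y) q)]
  · have : ∀ p q, D.sd p (fun x y => g (m x y) q) = epsi p • g 1 q := by
      intro p q
      rw [← (h1 q).2, ← hm, sd_map D (h1 q)]
    simp only [this]
    exact sd_counit_left D ω _ (h2 1)
  · intro y z; exact Lin.comp (h1 z) (hm1 y)
  · intro y z; exact Lin.comp (h1 z) (hm2 y)
  · intro x y; exact h2 _

theorem sd_comul_mul (a b : H) (g : H → H → V) (h1 : ∀ y, IsLinearMap ℂ (fun x => g x y))
    (h2 : ∀ x, IsLinearMap ℂ (fun y => g x y)) :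
    D.sd (a * b) g = D.sd a (fun x y => D.sd b (fun x' y' => g (x * x') (y * y'))) := by
  rw [sd_lift' D g h1 h2, Bialgebra.comul_mul, ← sd_tmul D a, ← sd_tmul D b]
  have e1 : (D.sd a fun x y => x ⊗ₜ[ℂ] y) * (D.sd b fun x y => x ⊗ₜ[ℂ] y)
    = D.sd a fun x y => D.sd b fun x' y' => (x * x') ⊗ₜ[ℂ] (y * y') := by
    rw [sd_map D (L := fun t => t * (D.sd b fun x y => x ⊗ₜ[ℂ] y)) (by fun_prop)]
    congr; ext x y
    rw [sd_map D (L := fun t => (x ⊗ₜ[ℂ] y) * t) (by fun_prop)]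
    simp
  rw [e1, sd_mapL]
  congr; ext x y
  rw [sd_mapL]
  rfl

theorem sd_one (g : H → H → V) (h1 : ∀ y, IsLinearMap ℂ (fun x => g x y))
    (h2 : ∀ x, IsLinearMap ℂ (fun y => g x y)) : D.sd 1 g = g 1 1 := by
  rw [sd_lift' D g h1 h2, Bialgebra.comul_one]; rfl

theorem sd_S (ω : H) (g : H → H → V) (h1 : ∀ y, IsLinearMap ℂ (fun x => g x y))
    (h2 : ∀ x, IsLinearMap ℂ (fun y => g x y)) :
    D.sd (SS ω) g = D.sd ω (fun x y => g (SS y) (SS x)) := by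
  open WithConv in
  have hG : IsLinearMap ℂ (fun ω => D.sd ω (fun x y => SS y ⊗ₜ[ℂ] SS x)) := by fun_prop
  have hinv : toConv hG.mk' * toConv (Coalgebra.comul (R := ℂ) (A := H)) = 1 := by
    ext ω
    rw [LinearMap.convMul_apply, ← sd_tmul D ω, sd_mapL, sd_mapL]
    simp only [TensorProduct.map_tmul, IsLinearMap.mk'_apply, LinearMap.mul'_apply,
      ← sd_tmul D]
    have e : ∀ p q, (D.sd p fun x y => SS y ⊗ₜ[ℂ] SS x) * (D.sd q fun x y => x ⊗ₜ[ℂ] y)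
      = D.sd p fun x y => D.sd q fun x' y' => (SS y * x') ⊗ₜ[ℂ] (SS x * y') := by
      intro a b
      rw [sd_map D (L := fun t => t * (D.sd b fun x y => x ⊗ₜ[ℂ] y)) (by fun_prop)]
      congr; ext x y
      rw [sd_map D (L := fun t => (SS y ⊗ₜ[ℂ] SS x) * t) (by fun_prop)]
      simp
    simp only [e]
    rw [sd_coassoc D ω (fun x y q => D.sd q fun x' y' => (SS y * x') ⊗ₜ[ℂ] (SS x * y'))
      (by fun_prop) (by fun_prop) (by fun_prop)]
    have e2 : ∀ x r, (D.sd r fun y q => D.sd q fun x' y' => (SS y * x') ⊗ₜ[ℂ] (SS x * y'))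
        = (1 : H) ⊗ₜ[ℂ] (SS x * r) := fun x r =>
      sd_collapse D r (fun y x' => SS y * x') (by fun_prop) (by fun_prop) (sd_S_left D)
        (fun a y' => a ⊗ₜ[ℂ] (SS x * y')) (by fun_prop) (by fun_prop)
    simp only [e2]
    rw [← sd_map D (L := fun t => (1 : H) ⊗ₜ[ℂ] t) (by fun_prop), sd_S_left]
    simp [epsi, Algebra.algebraMap_eq_smul_one, Algebra.TensorProduct.one_def]
  have := left_inv_eq_right_inv hinv (LinearMap.comul_right_inv (R := ℂ) (C := H))
  have h2' := congrArg (fun t => (WithConv.ofConv t) ω) this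
  simp only [IsLinearMap.mk'_apply, LinearMap.comp_apply] at h2'
  rw [sd_lift' D g h1 h2, ← h2', sd_mapL]
  rfl

theorem sd_Sinv (ω : H) (g : H → H → V) (h1 : ∀ y, IsLinearMap ℂ (fun x => g x y))
    (h2 : ∀ x, IsLinearMap ℂ (fun y => g x y)) :
    D.sd (D.Sinv ω) g = D.sd ω (fun x y => g (D.Sinv y) (D.Sinv x)) := by
  have h := sd_S D (D.Sinv ω) (fun x y => g (D.Sinv y) (D.Sinv x)) (by fun_prop) (by fun_prop)
  rw [D.antipode_Sinv] at h
  rw [h]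
  simp [D.Sinv_antipode]

theorem sd_comm (a b : H) (g : H → H → H → H → V) :
    D.sd a (fun x y => D.sd b (fun x' y' => g x y x' y'))
      = D.sd b (fun x' y' => D.sd a (fun x y => g x y x' y')) := by
  unfold HopfData.sd
  induction D.Δl a with
  | nil => simp
  | cons p l ih => simp only [List.map_cons, List.sum_cons, ih, List.sum_map_add]

theorem sw_succ' (n : ℕ) (ω : H) :
    D.sw (n + 1) ω = (D.Δl ω).flatMap fun p => (D.sw n p.2).map (fun v => Fin.cons p.1 v) := by
  induction n generalizing ω with
  | zero =>
    simp only [HopfData.sw, List.flatMap_cons, List.flatMap_nil, List.append_nil, List.map_cons,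
      List.map_nil]
    rw [← List.map_eq_flatMap]
    congr; ext p i
    fin_cases i
    · simp [Fin.snoc]
    · simp [Fin.snoc]
  | succ n ih =>
    rw [HopfData.sw, ih, List.flatMap_assoc]
    congr; ext1 p
    rw [List.flatMap_map]
    rw [HopfData.sw, List.map_flatMap]
    congr; ext1 v
    rw [List.map_map]
    have : (Fin.cons p.1 v : Fin (n + 2) → H) (Fin.last (n + 1)) = v (Fin.last n) := by
      rw [← Fin.succ_last, Fin.cons_succ]
    rw [this]
    congr; ext1 q
    simp only [Function.comp_apply]
    rw [← Fin.succ_last, ← Fin.cons_update]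
    exact (Fin.cons_snoc_eq_snoc_cons _ _ _).symm

theorem sum_sw_succ (n : ℕ) (ω : H) (g : (Fin (n + 2) → H) → V) :
    ((D.sw (n + 1) ω).map g).sum
      = D.sd ω (fun x r => ((D.sw n r).map fun v => g (Fin.cons x v)).sum) := by
  rw [sw_succ', List.map_flatMap, List.flatMap, List.sum_flatten]
  simp [HopfData.sd, List.map_map, Function.comp_def]

end SD

section Act
variable {H : Type} [Ring H] [HopfAlgebra ℂ H] (D : HopfData H)
variable {B : Type} [Ring B] [Algebra ℂ B]
variable {ι : Type} [Fintype ι] [DecidableEq ι] (P : MRep H ι) (A : RAct H B)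

/-- multilinear functionals on `B^{n+1}` -/
abbrev MLM (B : Type) [Ring B] [Algebra ℂ B] (n : ℕ) :=
  MultilinearMap ℂ (fun _ : Fin (n + 1) => B) ℂ

/-- bundling of `IsML` functions -/
def toMLM {n : ℕ} (f : Raw H B n) (hf : IsML f) : H →ₗ[ℂ] MLM B n where
  toFun ω :=
    { toFun := f ω
      map_update_add' := by
        intro inst m i x y
        have : inst = instDecidableEqFin _ := Subsingleton.elim _ _
        subst this; exact hf.2.2.1 ω m i x y
      map_update_smul' := by
        intro inst m i c x
        have : inst = instDecidableEqFin _ := Subsingleton.elim _ _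
        subst this; exact hf.2.2.2 ω m i c x }
  map_add' a b := by ext m; exact hf.1 a b m
  map_smul' c a := by ext m; exact hf.2.1 c a m

theorem toMLM_apply {n : ℕ} (f : Raw H B n) (hf : IsML f) (ω : H) (b : Fin (n + 1) → B) :
    toMLM f hf ω b = f ω b := rfl

/-- the matrix-trace extension of a multilinear functional -/
def Gam {n : ℕ} (M : Fin (n + 1) → Matrix ι ι B) : MLM B n →ₗ[ℂ] Matrix ι ι ℂ →ₗ[ℂ] ℂ :=
  LinearMap.mk₂ ℂ (fun φ c => ∑ k : Fin (n + 2) → ι,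
      c (k (Fin.last (n + 1))) (k 0) * φ fun i => M i (k i.castSucc) (k i.succ))
    (fun a b c => by simp [mul_add, Finset.sum_add_distrib])
    (fun r a c => by simp [Finset.mul_sum, mul_left_comm])
    (fun a b c => by simp [add_mul, Finset.sum_add_distrib])
    (fun r a c => by simp [Finset.mul_sum, mul_assoc])

theorem Gam_apply {n : ℕ} (M : Fin (n + 1) → Matrix ι ι B) (φ : MLM B n) (c : Matrix ι ι ℂ) :
    Gam M φ c = ∑ k : Fin (n + 2) → ι,
      c (k (Fin.last (n + 1))) (k 0) * φ fun i => M i (k i.castSucc) (k i.succ) := rfl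

theorem PsiRaw_eq {n : ℕ} (f : Raw H B n) (hf : IsML f) (ω : H) (M : Fin (n + 1) → Matrix ι ι B) :
    PsiRaw D P f ω M = D.sd ω (fun x y => Gam M (toMLM f hf x) (P.π (D.Sinv y))) := rfl

theorem Gam_cons {n : ℕ} (M : Fin (n + 2) → Matrix ι ι B) (φ : MLM B (n + 1))
    (c : Matrix ι ι ℂ) :
    Gam M φ c = ∑ a, ∑ b, Gam (Fin.tail M) (φ.curryLeft (M 0 a b)) (c * Matrix.single a b 1) := by
  simp only [Gam_apply]
  rw [← (Fin.consEquiv (fun _ : Fin (n + 3) => ι)).sum_comp, Fintype.sum_prod_type]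
  refine Finset.sum_congr rfl fun a _ => ?_
  rw [Finset.sum_comm]
  refine Finset.sum_congr rfl fun k _ => ?_
  rw [Finset.sum_eq_single (k 0)]
  · simp only [Fin.consEquiv_apply, Fin.cons_zero, MultilinearMap.curryLeft_apply]
    rw [Matrix.mul_single_apply_same, mul_one]
    congr 2
    ext i
    refine Fin.cases ?_ (fun j => ?_) i
    · simp
    · simp [Fin.tail]
  · intro b _ hb
    rw [Matrix.mul_single_apply_of_ne _ _ _ _ _ (Ne.symm hb)]; simp
  · simp

theorem Gam_zero (M : Fin 1 → Matrix ι ι B) (φ : MLM B 0) (c : Matrix ι ι ℂ) :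
    Gam M φ c = ∑ a, ∑ b, φ (fun _ => M 0 a b) * Matrix.trace (c * Matrix.single a b 1) := by
  simp only [Gam_apply]
  rw [← (finTwoArrowEquiv ι).symm.sum_comp, Fintype.sum_prod_type]
  refine Finset.sum_congr rfl fun a _ => Finset.sum_congr rfl fun b _ => ?_
  rw [Matrix.trace_mul_single]
  simp only [MulOpposite.op_one, one_smul]
  rw [mul_comm]
  congr 2
  ext i
  have : i = 0 := Fin.eq_zero i
  subst this
  rfl

/-- evaluation as a linear map -/
def evL {n : ℕ} (b : Fin (n + 1) → B) : MLM B n →ₗ[ℂ] ℂ where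
  toFun φ := φ b
  map_add' _ _ := rfl
  map_smul' _ _ := rfl

/-- the diagonal action on multilinear functionals (raw) -/
def dg0 (n : ℕ) (φ : MLM B n) (s : H) : MLM B n :=
  ((D.sw n s).map fun v => φ.compLinearMap (fun i => A.act (v i))).sum

theorem dg0_apply (n : ℕ) (φ : MLM B n) (s : H) (b : Fin (n + 1) → B) :
    dg0 D A n φ s b = ((D.sw n s).map fun v => φ (fun i => A.act (v i) (b i))).sum := by
  change evL b (dg0 D A n φ s) = _
  rw [dg0, map_list_sum, List.map_map]
  rfl

theorem dg0_cons (n : ℕ) (φ : MLM B (n + 1)) (s : H) (b : Fin (n + 2) → B) :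
    dg0 D A (n + 1) φ s b
      = D.sd s (fun x y => dg0 D A n (φ.curryLeft (A.act x (b 0))) y (Fin.tail b)) := by
  rw [dg0_apply, sum_sw_succ]
  congr; ext x y
  rw [dg0_apply]
  congr; ext v
  rw [MultilinearMap.curryLeft_apply]
  congr; ext i
  refine Fin.cases ?_ (fun j => ?_) i <;> simp [Fin.tail]

@[fun_prop] theorem Lin.evalM {n : ℕ} {M : Type*} [AddCommGroup M] [Module ℂ M] {f : M → MLM B n}
    (hf : IsLinearMap ℂ f) (b : Fin (n + 1) → B) : IsLinearMap ℂ (fun m => f m b) :=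
  ⟨fun _ _ => by simp [hf.1], fun _ _ => by simp [hf.2]⟩

theorem dg0_lin1 (n : ℕ) (s : H) : IsLinearMap ℂ (fun φ : MLM B n => dg0 D A n φ s) := by
  constructor
  · intro a b; ext m
    simp [dg0_apply, List.sum_map_add]
  · intro a b; ext m
    simp [dg0_apply, List.sum_map_mul_left]

theorem dg0_lin2 (n : ℕ) (φ : MLM B n) : IsLinearMap ℂ (fun s : H => dg0 D A n φ s) := by
  induction n with
  | zero =>
    have h : ∀ s b, dg0 D A 0 φ s b = φ.curryLeft (A.act s (b 0)) ![] := by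
      intro s b
      rw [dg0_apply, MultilinearMap.curryLeft_apply]
      simp only [HopfData.sw, List.map_cons, List.map_nil, List.sum_cons, List.sum_nil, add_zero]
      congr; ext i
      have : i = 0 := Fin.eq_zero i
      subst this; rfl
    constructor
    · intro a b; ext m
      simp only [_root_.add_apply, h, map_add, LinearMap.add_apply]
    · intro a b; ext m
      simp only [_root_.smul_apply, h, map_smul, LinearMap.smul_apply]
  | succ n ih =>
    have l1 := dg0_lin1 D A n
    have : ∀ b, IsLinearMap ℂ (fun s : H => dg0 D A (n + 1) φ s b) := by
      intro b
      simp only [dg0_cons]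
      apply Lin.sd1
      · fun_prop
      · intro y
        exact Lin.evalM (Lin.comp (l1 y) (by fun_prop)) _
      · intro x
        exact Lin.evalM (ih _) _
    constructor
    · intro a b; ext m; exact (this m).1 a b
    · intro a b; ext m; exact (this m).2 a b

/-- the diagonal action on multilinear functionals -/
def dg (n : ℕ) : MLM B n →ₗ[ℂ] H →ₗ[ℂ] MLM B n :=
  LinearMap.mk₂ ℂ (fun φ s => dg0 D A n φ s) (fun a b s => (dg0_lin1 D A n s).1 a b)
    (fun c a s => (dg0_lin1 D A n s).2 c a) (fun φ a b => (dg0_lin2 D A n φ).1 a b)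
    (fun c φ a => (dg0_lin2 D A n φ).2 c a)

theorem dg_apply (n : ℕ) (φ : MLM B n) (s : H) (b : Fin (n + 1) → B) :
    dg D A n φ s b = ((D.sw n s).map fun v => φ (fun i => A.act (v i) (b i))).sum :=
  dg0_apply D A n φ s b

theorem dg_curry (n : ℕ) (φ : MLM B (n + 1)) (s : H) (b : B) :
    (dg D A (n + 1) φ s).curryLeft b
      = D.sd s (fun x y => dg D A n (φ.curryLeft (A.act x b)) y) := by
  ext m
  rw [MultilinearMap.curryLeft_apply]
  change dg0 D A (n + 1) φ s _ = evL m _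
  rw [dg0_cons, sd_mapL]
  rfl

theorem matAct_eq (ω : H) (M : Matrix ι ι B) :
    matAct D P A ω M = D.sd ω (fun x r => D.sd r (fun y z =>
      ((P.π x).map (algebraMap ℂ B)) * (M.map fun b => A.act y b) *
          ((P.π (D.Sinv z)).map (algebraMap ℂ B)))) := by
  unfold matAct matActR
  rw [sum_sw_succ]
  congr; ext1 x; ext1 r
  rw [sum_sw_succ]
  congr; ext1 y; ext1 z
  simp [HopfData.sw]
  rfl

/-- matrix entry as a linear map -/
def entL (a b : ι) : Matrix ι ι B →ₗ[ℂ] B where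
  toFun M := M a b
  map_add' _ _ := rfl
  map_smul' _ _ := rfl

theorem lin_sum2 {V W : Type*} [AddCommGroup V] [Module ℂ V] [AddCommGroup W] [Module ℂ W]
    {L : V → W} (hL : IsLinearMap ℂ L) (c : ι → ι → ℂ) (v : ι → ι → V) :
    L (∑ d, ∑ e, c d e • v d e) = ∑ d, ∑ e, c d e • L (v d e) := by
  have : ∀ x, L x = IsLinearMap.mk' L hL x := fun _ => rfl
  simp only [this, map_sum, map_smul]

theorem sum4_comm {V : Type*} [AddCommGroup V] (g : ι → ι → ι → ι → V) :
    ∑ a, ∑ b, ∑ d, ∑ e, g a b d e = ∑ d, ∑ e, ∑ a, ∑ b, g a b d e := by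
  have h := Finset.sum_comm (s := (Finset.univ : Finset (ι × ι)))
    (t := (Finset.univ : Finset (ι × ι))) (f := fun p q => g p.1 p.2 q.1 q.2)
  simpa only [Fintype.sum_prod_type] using h

theorem matAct_sum {V : Type*} [AddCommGroup V] [Module ℂ V] (L : B → Matrix ι ι ℂ → V)
    (h1 : ∀ X, IsLinearMap ℂ (fun b => L b X)) (h2 : ∀ b, IsLinearMap ℂ (fun X => L b X))
    (ω : H) (M : Matrix ι ι B) :
    ∑ a, ∑ b, L (matAct D P A ω M a b) (Matrix.single a b 1)
      = D.sd ω (fun x r => D.sd r (fun y z => ∑ d, ∑ e,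
          L (A.act y (M d e)) (P.π x * Matrix.single d e 1 * P.π (D.Sinv z)))) := by
  have e1 : ∀ a b, L (matAct D P A ω M a b) (Matrix.single a b 1)
      = D.sd ω (fun x r => D.sd r (fun y z => ∑ d, ∑ e,
          (P.π x a d * P.π (D.Sinv z) e b) • L (A.act y (M d e)) (Matrix.single a b 1))) := by
    intro a b
    rw [matAct_eq]
    have hl : IsLinearMap ℂ (fun N : Matrix ι ι B => L (N a b) (Matrix.single a b 1)) :=
      Lin.comp (h1 (Matrix.single a b 1)) (entL (B := B) a b).isLinear
    rw [sd_map D hl]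
    congr; ext x r
    rw [sd_map D hl]
    congr; ext y z
    have : (((P.π x).map (algebraMap ℂ B)) * (M.map fun b => A.act y b) *
          ((P.π (D.Sinv z)).map (algebraMap ℂ B))) a b
        = ∑ d, ∑ e, (P.π x a d * P.π (D.Sinv z) e b) • A.act y (M d e) := by
      rw [Matrix.mul_apply, Finset.sum_comm]
      refine Finset.sum_congr rfl fun e _ => ?_
      rw [Matrix.mul_apply, Finset.sum_mul]
      refine Finset.sum_congr rfl fun d _ => ?_
      simp only [Matrix.map_apply, Algebra.smul_def, map_mul]
      rw [mul_assoc, ← Algebra.commutes (P.π (D.Sinv z) e b), mul_assoc]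
    simp only [this]
    rw [lin_sum2 (h1 (Matrix.single a b 1))]
  simp only [e1]
  simp only [← sd_sum]
  congr; ext x r
  congr; ext y z
  have e2 : ∀ d e, P.π x * Matrix.single d e 1 * P.π (D.Sinv z)
      = ∑ a, ∑ b, (P.π x a d * P.π (D.Sinv z) e b) • Matrix.single a b (1 : ℂ) := by
    intro d e
    conv_lhs => rw [Matrix.matrix_eq_sum_single (P.π x * Matrix.single d e 1 * P.π (D.Sinv z))]
    refine Finset.sum_congr rfl fun a _ => Finset.sum_congr rfl fun b _ => ?_
    rw [Matrix.smul_single]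
    congr 1
    rw [Matrix.mul_apply, Finset.sum_eq_single e]
    · simp
    · intro j _ hj; rw [Matrix.mul_single_apply_of_ne _ _ _ _ _ hj]; simp
    · simp
  have e3 : ∀ d e, L (A.act y (M d e)) (P.π x * Matrix.single d e 1 * P.π (D.Sinv z))
      = ∑ a, ∑ b, (P.π x a d * P.π (D.Sinv z) e b) • L (A.act y (M d e)) (Matrix.single a b 1) := by
    intro d e
    rw [e2, lin_sum2 (h2 (A.act y (M d e)))]
  simp only [e3]
  exact sum4_comm _
end Act

section Claim
variable {H : Type} [Ring H] [HopfAlgebra ℂ H] (D : HopfData H)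
variable {B : Type} [Ring B] [Algebra ℂ B]
variable {ι : Type} [Fintype ι] [DecidableEq ι] (P : MRep H ι) (A : RAct H B)

theorem sd_congr {V : Type*} [AddCommGroup V] (ω : H) {g h : H → H → V}
    (e : ∀ x y, g x y = h x y) : D.sd ω g = D.sd ω h := by
  have : g = h := by ext x y; exact e x y
  rw [this]

@[fun_prop] theorem Lin.trace {M : Type*} [AddCommGroup M] [Module ℂ M] {f : M → Matrix ι ι ℂ}
    (hf : IsLinearMap ℂ f) : IsLinearMap ℂ (fun m => Matrix.trace (f m)) :=
  Lin.comp (Matrix.traceLinearMap ι ℂ ℂ).isLinear hf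

theorem Lin.mlm0 (φ : MLM B 0) : IsLinearMap ℂ (fun b => φ (fun _ => b)) := by
  have h : ∀ b, φ (fun _ => b) = φ.curryLeft b ![] := by
    intro b
    rw [MultilinearMap.curryLeft_apply]
    congr; ext i
    have : i = 0 := Fin.eq_zero i
    subst this; rfl
  simp only [h]
  constructor
  · intro a b; rw [map_add, _root_.add_apply]
  · intro a b; rw [map_smul, _root_.smul_apply]

theorem gam_act (n : ℕ) (φ : MLM B n) (c : Matrix ι ι ℂ) (M : Fin (n + 1) → Matrix ι ι B)
    (ω : H) :
    ((D.sw n ω).map fun v => Gam (fun i => matAct D P A (v i) (M i)) φ c).sum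
      = D.sd ω (fun x r => D.sd r (fun y z =>
          Gam M (dg D A n φ y) (P.π (D.Sinv z) * c * P.π x))) := by
  induction n generalizing c ω with
  | zero =>
    simp only [HopfData.sw, List.map_cons, List.map_nil, List.sum_cons, List.sum_nil, add_zero]
    rw [Gam_zero]
    have hφ := Lin.mlm0 φ
    rw [matAct_sum D P A (fun b X => φ (fun _ => b) * Matrix.trace (c * X)) (fun X => Lin.mul1 _ hφ)
      (by fun_prop)]
    refine sd_congr D _ fun x r => sd_congr D _ fun y z => ?_
    rw [Gam_zero]
    refine Finset.sum_congr rfl fun d _ => Finset.sum_congr rfl fun e _ => ?_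
    congr 1
    · rw [dg_apply]; simp [HopfData.sw]
    · rw [← Matrix.mul_assoc, Matrix.trace_mul_comm]
      simp only [Matrix.mul_assoc]
  | succ n ih =>
    rw [sum_sw_succ]
    have s1 : ∀ p q, ((D.sw n q).map fun v => Gam (fun i => matAct D P A
          ((Fin.cons p v : Fin (n + 2) → H) i) (M i)) φ c).sum
        = D.sd p (fun x' r' => D.sd r' (fun y' z' => D.sd q (fun x r => D.sd r (fun y z =>
            ∑ d, ∑ e, Gam (Fin.tail M) (dg D A n (φ.curryLeft (A.act y' (M 0 d e))) y)
              (P.π (D.Sinv z) * (c * (P.π x' * Matrix.single d e 1)) *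
                P.π (x * D.Sinv z')))))) := by
      intro p q
      have t1 : ∀ v : Fin (n + 1) → H, Gam (fun i => matAct D P A
          ((Fin.cons p v : Fin (n + 2) → H) i) (M i)) φ c
          = ∑ a, ∑ b, Gam (fun i => matAct D P A (v i) (Fin.tail M i))
              (φ.curryLeft (matAct D P A p (M 0) a b)) (c * Matrix.single a b 1) := by
        intro v
        rw [Gam_cons]
        rfl
      simp only [t1]
      have t2 : ∀ (l : List (Fin (n + 1) → H)) (g : ι → ι → (Fin (n + 1) → H) → ℂ),
          (l.map fun v => ∑ a, ∑ b, g a b v).sum = ∑ a, ∑ b, (l.map fun v => g a b v).sum := by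
        intro l g
        induction l with
        | nil => simp
        | cons v l ih => simp [ih, Finset.sum_add_distrib]
      rw [t2]
      simp only [ih]
      rw [matAct_sum D P A (fun b X => D.sd q (fun x r => D.sd r (fun y z =>
        Gam (Fin.tail M) (dg D A n (φ.curryLeft b) y) (P.π (D.Sinv z) * (c * X) * P.π x))))
        (by fun_prop) (by fun_prop)]
      refine sd_congr D _ fun x' r' => sd_congr D _ fun y' z' => ?_
      simp only [← sd_sum]
      refine sd_congr D _ fun x r => sd_congr D _ fun y z => ?_
      refine Finset.sum_congr rfl fun d _ => Finset.sum_congr rfl fun e _ => ?_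
      rw [P.π_mul]
      simp only [Matrix.mul_assoc]
    simp only [s1]
    rw [sd_coassoc D ω (fun x' r' q => D.sd r' (fun y' z' => D.sd q (fun x r => D.sd r (fun y z =>
            ∑ d, ∑ e, Gam (Fin.tail M) (dg D A n (φ.curryLeft (A.act y' (M 0 d e))) y)
              (P.π (D.Sinv z) * (c * (P.π x' * Matrix.single d e 1)) *
                P.π (x * D.Sinv z')))))) (by fun_prop) (by fun_prop) (by fun_prop)]
    refine sd_congr D _ fun x' s => ?_
    rw [sd_coassoc D s (fun y' z' q => D.sd q (fun x r => D.sd r (fun y z =>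
            ∑ d, ∑ e, Gam (Fin.tail M) (dg D A n (φ.curryLeft (A.act y' (M 0 d e))) y)
              (P.π (D.Sinv z) * (c * (P.π x' * Matrix.single d e 1)) *
                P.π (x * D.Sinv z'))))) (by fun_prop) (by fun_prop) (by fun_prop)]
    have s2 : ∀ u z, Gam M (dg D A (n + 1) φ u) (P.π (D.Sinv z) * c * P.π x')
        = D.sd u (fun y' y => ∑ d, ∑ e, Gam (Fin.tail M)
            (dg D A n (φ.curryLeft (A.act y' (M 0 d e))) y)
              (P.π (D.Sinv z) * (c * (P.π x' * Matrix.single d e 1)))) := by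
      intro u z
      rw [Gam_cons]
      simp only [dg_curry, sd_sum]
      refine Finset.sum_congr rfl fun d _ => Finset.sum_congr rfl fun e _ => ?_
      rw [sd_map D (L := fun t => Gam (Fin.tail M) t
        (P.π (D.Sinv z) * c * P.π x' * Matrix.single d e 1)) (by fun_prop)]
      simp only [Matrix.mul_assoc]
    simp only [s2]
    rw [sd_coassoc D s (fun y' y z => ∑ d, ∑ e, Gam (Fin.tail M)
            (dg D A n (φ.curryLeft (A.act y' (M 0 d e))) y)
              (P.π (D.Sinv z) * (c * (P.π x' * Matrix.single d e 1))))
              (by fun_prop) (by fun_prop) (by fun_prop)]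
    refine sd_congr D _ fun y' t => ?_
    have := sd_collapse D t (fun z' x => x * D.Sinv z') (by fun_prop) (by fun_prop)
      (sd_Sinv_right D) (fun w r => D.sd r (fun y z =>
            ∑ d, ∑ e, Gam (Fin.tail M) (dg D A n (φ.curryLeft (A.act y' (M 0 d e))) y)
              (P.π (D.Sinv z) * (c * (P.π x' * Matrix.single d e 1)) *
                P.π w))) (by fun_prop) (by fun_prop)
    rw [this]
    simp only [P.π_one, Matrix.mul_one]

end Claim

section Inv
variable {H : Type} [Ring H] [HopfAlgebra ℂ H] (D : HopfData H)
variable {B : Type} [Ring B] [Algebra ℂ B]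
variable {ι : Type} [Fintype ι] [DecidableEq ι] (P : MRep H ι) (A : RAct H B)

theorem list_sd_comm {V κ : Type*} [AddCommGroup V] (l : List κ) (a : H) (g : κ → H → H → V) :
    (l.map fun v => D.sd a (g v)).sum = D.sd a (fun x y => (l.map fun v => g v x y).sum) := by
  unfold HopfData.sd
  induction l with
  | nil => simp
  | cons p l ih => simp only [List.map_cons, List.sum_cons, ih, List.sum_map_add]

theorem upd_entry {n : ℕ} (M : Fin (n + 1) → Matrix ι ι B) (i : Fin (n + 1)) (X : Matrix ι ι B)
    (k : Fin (n + 2) → ι) :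
    (fun j : Fin (n + 1) => (Function.update M i X) j (k j.castSucc) (k j.succ))
      = Function.update (fun j : Fin (n + 1) => M j (k j.castSucc) (k j.succ)) i
          (X (k i.castSucc) (k i.succ)) := by
  ext j
  by_cases h : j = i
  · subst h; simp
  · simp [h]

theorem Psi_ML {n : ℕ} (f : Raw H B n) (hf : IsML f) : IsML (PsiRaw D P f) := by
  have l1 : ∀ M, IsLinearMap ℂ (fun ω => PsiRaw D P f ω M) := by
    intro M
    simp only [PsiRaw_eq D P f hf]
    fun_prop
  refine ⟨fun ω η b => (l1 b).1 ω η, fun c ω b => (l1 b).2 c ω, ?_, ?_⟩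
  · intro ω M i X Y
    simp only [PsiRaw_eq D P f hf]
    rw [← sd_add]
    refine sd_congr D _ fun x y => ?_
    simp only [Gam_apply, upd_entry, Matrix.add_apply, MultilinearMap.map_update_add, mul_add,
      Finset.sum_add_distrib]
  · intro ω M i c X
    simp only [PsiRaw_eq D P f hf]
    rw [← sd_mul]
    refine sd_congr D _ fun x y => ?_
    simp only [Gam_apply, upd_entry, Matrix.smul_apply, MultilinearMap.map_update_smul,
      Finset.mul_sum, smul_eq_mul]
    exact Finset.sum_congr rfl fun k _ => mul_left_comm _ _ _

theorem inv_MLM {n : ℕ} (f : Raw H B n) (hf : IsML f) (hi : IsInv D A.fn f) (s η : H) :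
    D.sd s (fun x r => D.sd r (fun y b => dg D A n (toMLM f hf (D.Sinv x * η * y)) b))
      = epsi s • toMLM f hf η := by
  ext b
  have := hi s η b
  rw [sum_sw_succ] at this
  simp only [sum_sw_succ] at this
  change evL b _ = epsi s * f η b
  rw [← this, sd_mapL]
  refine sd_congr D _ fun x r => ?_
  rw [sd_mapL]
  refine sd_congr D _ fun y t => ?_
  change dg D A n _ t b = _
  rw [dg_apply]
  rfl

theorem sd_comm3 {V : Type*} [AddCommGroup V] [Module ℂ V] (ω η : H) (g : H → H → H → H → H → H → V) :
    D.sd ω (fun x r => D.sd r (fun y s => D.sd η (fun a b => g x r y s a b)))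
      = D.sd η (fun a b => D.sd ω (fun x r => D.sd r (fun y s => g x r y s a b))) := by
  have h : ∀ x r, D.sd r (fun y s => D.sd η (fun a b => g x r y s a b))
      = D.sd η (fun a b => D.sd r (fun y s => g x r y s a b)) := fun x r => sd_comm D _ _ _
  simp only [h]
  exact sd_comm D _ _ _

theorem inv_core {n : ℕ} (F : H →ₗ[ℂ] MLM B n)
    (hF : ∀ s η, D.sd s (fun x r => D.sd r (fun y b => dg D A n (F (D.Sinv x * η * y)) b))
      = epsi s • F η) (ω η1 : H) (M : Fin (n + 1) → Matrix ι ι B) (c : Matrix ι ι ℂ) :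
    D.sd ω (fun x r => D.sd r (fun y s => D.sd x (fun x1 x2 => D.sd y (fun y1 y2 =>
          D.sd s (fun a t => D.sd t (fun b d =>
            Gam M (dg D A n (F (D.Sinv x2 * η1 * y1)) b)
              (P.π (D.Sinv d) * (P.π (D.Sinv (D.Sinv x1)) * (c *
                P.π (a * D.Sinv y2))))))))))
      = epsi ω * Gam M (F η1) c := by
  have h1 : ∀ x r, D.sd r (fun y s => D.sd x (fun x1 x2 => D.sd y (fun y1 y2 =>
          D.sd s (fun a t => D.sd t (fun b d =>
            Gam M (dg D A n (F (D.Sinv x2 * η1 * y1)) b)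
              (P.π (D.Sinv d) * (P.π (D.Sinv (D.Sinv x1)) * (c *
                P.π (a * D.Sinv y2)))))))))
      = D.sd x (fun x1 x2 => D.sd r (fun y s => D.sd y (fun y1 y2 =>
          D.sd s (fun a t => D.sd t (fun b d =>
            Gam M (dg D A n (F (D.Sinv x2 * η1 * y1)) b)
              (P.π (D.Sinv d) * (P.π (D.Sinv (D.Sinv x1)) * (c *
                P.π (a * D.Sinv y2))))))))) := fun x r => sd_comm D _ _ _
  simp only [h1]
  have h2 : ∀ x1 x2 r, D.sd r (fun y s => D.sd y (fun y1 y2 =>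
          D.sd s (fun a t => D.sd t (fun b d =>
            Gam M (dg D A n (F (D.Sinv x2 * η1 * y1)) b)
              (P.π (D.Sinv d) * (P.π (D.Sinv (D.Sinv x1)) * (c *
                P.π (a * D.Sinv y2))))))))
      = D.sd r (fun y1 q => D.sd q (fun b d =>
            Gam M (dg D A n (F (D.Sinv x2 * η1 * y1)) b)
              (P.π (D.Sinv d) * (P.π (D.Sinv (D.Sinv x1)) * c)))) := by
    intro x1 x2 r
    rw [sd_coassoc D r (fun y1 y2 s => D.sd s (fun a t => D.sd t (fun b d =>
            Gam M (dg D A n (F (D.Sinv x2 * η1 * y1)) b)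
              (P.π (D.Sinv d) * (P.π (D.Sinv (D.Sinv x1)) * (c *
                P.π (a * D.Sinv y2))))))) (by fun_prop) (by fun_prop) (by fun_prop)]
    refine sd_congr D _ fun y1 q => ?_
    have := sd_collapse D q (fun y2 a => a * D.Sinv y2) (by fun_prop) (by fun_prop)
      (sd_Sinv_right D) (fun w t => D.sd t (fun b d =>
            Gam M (dg D A n (F (D.Sinv x2 * η1 * y1)) b)
              (P.π (D.Sinv d) * (P.π (D.Sinv (D.Sinv x1)) * (c *
                P.π w))))) (by fun_prop) (by fun_prop)
    rw [this]
    simp only [P.π_one, Matrix.mul_one]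
  simp only [h2]
  rw [sd_coassoc D ω (fun x1 x2 r => D.sd r (fun y1 q => D.sd q (fun b d =>
            Gam M (dg D A n (F (D.Sinv x2 * η1 * y1)) b)
              (P.π (D.Sinv d) * (P.π (D.Sinv (D.Sinv x1)) * c)))))
              (by fun_prop) (by fun_prop) (by fun_prop)]
  have h3 : ∀ x1 q, D.sd q (fun x2 r => D.sd r (fun y1 q => D.sd q (fun b d =>
            Gam M (dg D A n (F (D.Sinv x2 * η1 * y1)) b)
              (P.π (D.Sinv d) * (P.π (D.Sinv (D.Sinv x1)) * c)))))
      = Gam M (F η1) (P.π (D.Sinv (q * D.Sinv x1)) * c) := by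
    intro x1 q
    have h4 : ∀ x2 r, D.sd r (fun y1 q => D.sd q (fun b d =>
            Gam M (dg D A n (F (D.Sinv x2 * η1 * y1)) b)
              (P.π (D.Sinv d) * (P.π (D.Sinv (D.Sinv x1)) * c))))
        = D.sd r (fun r1 d => D.sd r1 (fun y1 b =>
            Gam M (dg D A n (F (D.Sinv x2 * η1 * y1)) b)
              (P.π (D.Sinv d) * (P.π (D.Sinv (D.Sinv x1)) * c)))) := fun x2 r =>
      (sd_coassoc D r (fun y1 b d => Gam M (dg D A n (F (D.Sinv x2 * η1 * y1)) b)
              (P.π (D.Sinv d) * (P.π (D.Sinv (D.Sinv x1)) * c)))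
              (by fun_prop) (by fun_prop) (by fun_prop)).symm
    simp only [h4]
    rw [← sd_coassoc D q (fun x2 r1 d => D.sd r1 (fun y1 b =>
            Gam M (dg D A n (F (D.Sinv x2 * η1 * y1)) b)
              (P.π (D.Sinv d) * (P.π (D.Sinv (D.Sinv x1)) * c))))
              (by fun_prop) (by fun_prop) (by fun_prop)]
    have h5 : ∀ q1 d, D.sd q1 (fun x2 r1 => D.sd r1 (fun y1 b =>
            Gam M (dg D A n (F (D.Sinv x2 * η1 * y1)) b)
              (P.π (D.Sinv d) * (P.π (D.Sinv (D.Sinv x1)) * c))))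
        = epsi q1 • Gam M (F η1) (P.π (D.Sinv d) * (P.π (D.Sinv (D.Sinv x1)) * c)) := by
      intro q1 d
      have hl : IsLinearMap ℂ (fun φ : MLM B n => Gam M φ
        (P.π (D.Sinv d) * (P.π (D.Sinv (D.Sinv x1)) * c))) := by fun_prop
      rw [← hl.2, ← hF, sd_map D hl]
      refine sd_congr D _ fun x r => ?_
      rw [sd_map D hl]
    simp only [h5]
    rw [sd_counit_left D q (fun d => Gam M (F η1)
      (P.π (D.Sinv d) * (P.π (D.Sinv (D.Sinv x1)) * c))) (by fun_prop)]
    simp only [Sinv_mul, P.π_mul, Matrix.mul_assoc]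
  simp only [h3]
  rw [← sd_map D (L := fun w => Gam M (F η1) (P.π (D.Sinv w) * c)) (by fun_prop), sd_Sinv_right]
  simp [Sinv_one, P.π_one]

theorem Psi_Inv {n : ℕ} (f : Raw H B n) (hf : IsML f) (hi : IsInv D A.fn f) :
    IsInv D (matAct D P A) (PsiRaw D P f) := by
  intro ω η M
  rw [sum_sw_succ]
  simp only [sum_sw_succ]
  set F := toMLM f hf with hF
  -- the nine-leg integrand
  have s1 : ∀ x y s, ((D.sw n s).map fun v => PsiRaw D P f
        (D.Sinv ((Fin.cons x (Fin.cons y v : Fin (n + 2) → H) : Fin (n + 3) → H) 0) * η *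
          (Fin.cons x (Fin.cons y v : Fin (n + 2) → H) : Fin (n + 3) → H) 1)
        fun i => matAct D P A
          ((Fin.cons x (Fin.cons y v : Fin (n + 2) → H) : Fin (n + 3) → H) i.succ.succ) (M i)).sum
      = D.sd η (fun η1 η2 => D.sd x (fun x1 x2 => D.sd y (fun y1 y2 =>
          D.sd s (fun a t => D.sd t (fun b d =>
            Gam M (dg D A n (F (D.Sinv x2 * η1 * y1)) b)
              (P.π (D.Sinv d) * (P.π (D.Sinv (D.Sinv x1)) * (P.π (D.Sinv η2) *
                P.π (a * D.Sinv y2))))))))) := by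
    intro x y s
    have e0 : ∀ v : Fin (n + 1) → H, PsiRaw D P f
        (D.Sinv ((Fin.cons x (Fin.cons y v : Fin (n + 2) → H) : Fin (n + 3) → H) 0) * η *
          (Fin.cons x (Fin.cons y v : Fin (n + 2) → H) : Fin (n + 3) → H) 1)
        (fun i => matAct D P A
          ((Fin.cons x (Fin.cons y v : Fin (n + 2) → H) : Fin (n + 3) → H) i.succ.succ) (M i))
        = D.sd (D.Sinv x * η * y) (fun u w =>
            Gam (fun i => matAct D P A (v i) (M i)) (F u) (P.π (D.Sinv w))) := fun v => rfl
    simp only [e0]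
    rw [list_sd_comm]
    simp only [gam_act]
    rw [sd_comul_mul D _ _ _ (by fun_prop) (by fun_prop),
      sd_comul_mul D _ _ _ (by fun_prop) (by fun_prop),
      sd_Sinv D _ _ (by fun_prop) (by fun_prop), sd_comm]
    refine sd_congr D _ fun η1 η2 => sd_congr D _ fun x1 x2 => sd_congr D _ fun y1 y2 =>
      sd_congr D _ fun a t => sd_congr D _ fun b d => ?_
    congr 1
    simp only [Sinv_mul, P.π_mul, Matrix.mul_assoc]
  simp only [s1]
  rw [PsiRaw_eq D P f hf, sd_comm3, ← sd_mul]
  refine sd_congr D _ fun η1 η2 => ?_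
  exact inv_core D P A F (inv_MLM D A f hf hi) ω η1 M (P.π (D.Sinv η2))

/-- evaluation on a tuple with prescribed first entry -/
def consE {n : ℕ} (m : Fin n → B) : MLM B n →ₗ[ℂ] B →ₗ[ℂ] ℂ :=
  LinearMap.mk₂ ℂ (fun φ b => φ (Fin.cons b m : Fin (n + 1) → B))
    (fun _ _ _ => rfl) (fun _ _ _ => rfl)
    (fun φ a b => φ.cons_add m a b) (fun c φ a => φ.cons_smul m c a)

theorem Gam_cons' {n : ℕ} (M : Fin (n + 1) → Matrix ι ι B) (φ : MLM B n)
    (c : Matrix ι ι ℂ) :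
    Gam M φ c = ∑ a, ∑ b, ∑ k : Fin (n + 1) → ι,
      entL (B := ℂ) (k (Fin.last n)) (k 0) (c * Matrix.single a b 1) *
        consE (fun i : Fin n => M i.succ (k i.castSucc) (k i.succ)) φ (M 0 a b) := by
  simp only [Gam_apply]
  rw [← (Fin.consEquiv (fun _ : Fin (n + 2) => ι)).sum_comp, Fintype.sum_prod_type]
  refine Finset.sum_congr rfl fun a _ => ?_
  rw [Finset.sum_comm]
  refine Finset.sum_congr rfl fun k _ => ?_
  rw [Finset.sum_eq_single (k 0)]
  · simp only [Fin.consEquiv_apply, Fin.cons_zero]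
    change _ = (c * Matrix.single a (k 0) 1 : Matrix ι ι ℂ) (k (Fin.last n)) (k 0) *
      φ (Fin.cons (M 0 a (k 0)) (fun i : Fin n => M i.succ (k i.castSucc) (k i.succ)))
    rw [Matrix.mul_single_apply_same, mul_one]
    congr 2
    ext i
    refine Fin.cases ?_ (fun j => ?_) i
    · simp
    · simp
  · intro b _ hb
    change (c * Matrix.single a b 1 : Matrix ι ι ℂ) (k (Fin.last n)) (k 0) * _ = 0
    rw [Matrix.mul_single_apply_of_ne _ _ _ _ _ (Ne.symm hb)]; simp
  · simp

theorem Psi_t {n : ℕ} (f : Raw H B n) (hf : IsML f) :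
    PsiRaw D P (tRaw D A.fn f) = tRaw D (matAct D P A) (PsiRaw D P f) := by
  ext ω M
  set F := toMLM f hf with hF
  set m : (Fin (n + 1) → ι) → Fin n → B :=
    fun k i => M i.castSucc (k i.castSucc) (k i.succ) with hm
  have hR : tRaw D (matAct D P A) (PsiRaw D P f) ω M
      = D.sd ω (fun x y => D.sd x (fun x1 x2 => D.sd y (fun u r => D.sd r (fun v w =>
          ∑ d, ∑ e, ∑ k : Fin (n + 1) → ι,
            entL (B := ℂ) (k (Fin.last n)) (k 0) (P.π (u * D.Sinv x2) *
              (Matrix.single d e 1 * P.π (D.Sinv w))) *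
              consE (m k) (F x1) (A.act v (M (Fin.last n) d e)))))) := by
    change D.sd ω (fun x y => D.sd x (fun x1 x2 => Gam (Fin.cons (matAct D P A y (M (Fin.last n)))
      fun i : Fin n => M i.castSucc) (F x1) (P.π (D.Sinv x2)))) = _
    refine sd_congr D _ fun x y => sd_congr D _ fun x1 x2 => ?_
    rw [Gam_cons']
    refine (matAct_sum D P A (fun b X => ∑ k : Fin (n + 1) → ι,
      entL (B := ℂ) (k (Fin.last n)) (k 0) (P.π (D.Sinv x2) * X) *
        consE (m k) (F x1) b) (by fun_prop) (by fun_prop) y (M (Fin.last n))).trans ?_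
    refine sd_congr D _ fun u r => sd_congr D _ fun v w => ?_
    simp only [P.π_mul, Matrix.mul_assoc]
  have hL : PsiRaw D P (tRaw D A.fn f) ω M
      = D.sd ω (fun x y => D.sd x (fun x1 x2 => ∑ d, ∑ e, ∑ k : Fin (n + 1) → ι,
            entL (B := ℂ) (k (Fin.last n)) (k 0)
              (Matrix.single d e 1 * P.π (D.Sinv y)) *
              consE (m k) (F x1) (A.act x2 (M (Fin.last n) d e)))) := by
    change D.sd ω (fun x y => ∑ k : Fin (n + 2) → ι,
      P.π (D.Sinv y) (k (Fin.last (n + 1))) (k 0) * D.sd x (fun x1 x2 =>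
        consE (fun i : Fin n => M i.castSucc (k i.castSucc.castSucc) (k i.castSucc.succ)) (F x1)
          (A.act x2 (M (Fin.last n) (k (Fin.last n).castSucc) (k (Fin.last n).succ))))) = _
    refine sd_congr D _ fun x y => ?_
    simp only [← sd_mul, ← sd_sum]
    refine sd_congr D _ fun x1 x2 => ?_
    rw [← (Fin.snocEquiv (fun _ : Fin (n + 2) => ι)).sum_comp, Fintype.sum_prod_type]
    refine Eq.trans ?_ Finset.sum_comm
    refine Finset.sum_congr rfl fun e _ => ?_
    refine Eq.trans ?_ Finset.sum_comm
    refine Finset.sum_congr rfl fun k _ => ?_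
    rw [Finset.sum_eq_single (k (Fin.last n))]
    · change _ = (Matrix.single (k (Fin.last n)) e 1 * P.π (D.Sinv y) : Matrix ι ι ℂ)
        (k (Fin.last n)) (k 0) * _
      rw [Matrix.single_mul_apply_same, one_mul]
      have e0 : ∀ i : Fin (n + 1), (Fin.snoc k e : Fin (n + 2) → ι) i.castSucc = k i :=
        fun i => by simp
      have e1 : (Fin.snoc k e : Fin (n + 2) → ι) 0 = k 0 := e0 0
      have e2 : (Fin.snoc k e : Fin (n + 2) → ι) (Fin.last (n + 1)) = e := by simp
      simp only [Fin.snocEquiv_apply, Fin.succ_castSucc, Fin.succ_last, e0, e1, e2, hm]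
    · intro d _ hd
      change (Matrix.single d e 1 * P.π (D.Sinv y) : Matrix ι ι ℂ) (k (Fin.last n)) (k 0) * _ = 0
      rw [Matrix.single_mul_apply_of_ne _ _ _ _ _ (Ne.symm hd)]; simp
    · simp
  rw [hL, hR]
  rw [sd_coassoc D ω (fun x1 x2 y => ∑ d, ∑ e, ∑ k : Fin (n + 1) → ι,
            entL (B := ℂ) (k (Fin.last n)) (k 0)
              (Matrix.single d e 1 * P.π (D.Sinv y)) *
              consE (m k) (F x1) (A.act x2 (M (Fin.last n) d e)))
              (by fun_prop) (by fun_prop) (by fun_prop)]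
  rw [sd_coassoc D ω (fun x1 x2 y => D.sd y (fun u r => D.sd r (fun v w =>
          ∑ d, ∑ e, ∑ k : Fin (n + 1) → ι,
            entL (B := ℂ) (k (Fin.last n)) (k 0) (P.π (u * D.Sinv x2) *
              (Matrix.single d e 1 * P.π (D.Sinv w))) *
              consE (m k) (F x1) (A.act v (M (Fin.last n) d e)))))
              (by fun_prop) (by fun_prop) (by fun_prop)]
  refine sd_congr D _ fun x1 s => ?_
  have := sd_collapse D s (fun x2 u => u * D.Sinv x2) (by fun_prop) (by fun_prop)
      (sd_Sinv_right D) (fun q r => D.sd r (fun v w =>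
          ∑ d, ∑ e, ∑ k : Fin (n + 1) → ι,
            entL (B := ℂ) (k (Fin.last n)) (k 0) (P.π q *
              (Matrix.single d e 1 * P.π (D.Sinv w))) *
              consE (m k) (F x1) (A.act v (M (Fin.last n) d e)))) (by fun_prop) (by fun_prop)
  rw [this]
  simp only [P.π_one, Matrix.one_mul]

end Inv

section Simp
variable {H : Type} [Ring H] [HopfAlgebra ℂ H] (D : HopfData H)
variable {B : Type} [Ring B] [Algebra ℂ B]
variable {ι : Type} [Fintype ι] [DecidableEq ι] (P : MRep H ι) (A : RAct H B)

theorem ins_lt {n : ℕ} (p : Fin (n + 1)) (x : ι) (k : Fin n → ι) (q : Fin n)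
    (h : q.castSucc < p) : (Fin.insertNth p x k : Fin (n + 1) → ι) q.castSucc = k q := by
  rw [← Fin.succAbove_of_castSucc_lt p q h, Fin.insertNth_apply_succAbove]

theorem ins_ge {n : ℕ} (p : Fin (n + 1)) (x : ι) (k : Fin n → ι) (q : Fin n)
    (h : p ≤ q.castSucc) : (Fin.insertNth p x k : Fin (n + 1) → ι) q.succ = k q := by
  rw [← Fin.succAbove_of_le_castSucc p q h, Fin.insertNth_apply_succAbove]

theorem Gam_contract {n : ℕ} (i : Fin (n + 1)) (M : Fin (n + 2) → Matrix ι ι B) (φ : MLM B n)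
    (c : Matrix ι ι ℂ) :
    (∑ k : Fin (n + 3) → ι, c (k (Fin.last (n + 2))) (k 0) *
        φ (contract i fun j => M j (k j.castSucc) (k j.succ)))
      = Gam (contract i M) φ c := by
  rw [Gam_apply, ← (Fin.insertNthEquiv (fun _ : Fin (n + 3) => ι) i.succ.castSucc).sum_comp,
    Fintype.sum_prod_type, Finset.sum_comm]
  refine Finset.sum_congr rfl fun k _ => ?_
  simp only [Fin.insertNthEquiv_apply]
  have e0 : ∀ x, (Fin.insertNth i.succ.castSucc x k : Fin (n + 3) → ι) 0 = k 0 := fun x =>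
    ins_lt _ x k 0 (by simp [Fin.lt_def])
  have e1 : ∀ x, (Fin.insertNth i.succ.castSucc x k : Fin (n + 3) → ι) (Fin.last (n + 2))
      = k (Fin.last (n + 1)) := fun x =>
    ins_ge _ x k (Fin.last (n + 1)) (by simp [Fin.le_def]; omega)
  simp only [e0, e1]
  rw [← Finset.mul_sum]
  congr 1
  set w : Fin (n + 1) → B := fun j => (contract i M) j (k j.castSucc) (k j.succ) with hw
  have hwi : w = Function.update w i
      (∑ x, M i.castSucc (k i.castSucc) x * M i.succ x (k i.succ)) := by
    rw [eq_comm, Function.update_eq_self_iff]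
    simp [hw, contract, Matrix.mul_apply]
  rw [hwi, MultilinearMap.map_update_sum]
  refine Finset.sum_congr rfl fun x _ => ?_
  congr 1
  ext j
  rcases lt_trichotomy (j : ℕ) (i : ℕ) with h | h | h
  · rw [Function.update_of_ne (by rintro rfl; omega)]
    simp only [hw, contract, h, if_true]
    rw [Fin.succ_castSucc, ins_lt, ins_lt]
    · simp only [Fin.lt_def, Fin.val_succ, Fin.val_castSucc]; omega
    · simp only [Fin.lt_def, Fin.val_succ, Fin.val_castSucc]; omega
  · have : j = i := Fin.ext h
    subst this
    simp only [Function.update_self, contract, lt_irrefl, if_false, if_true]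
    rw [ins_lt _ x k j.castSucc (by simp [Fin.lt_def]),
      ins_ge _ x k j.succ (le_refl _), Fin.succ_castSucc, Fin.insertNth_apply_same]
  · rw [Function.update_of_ne (by rintro rfl; omega)]
    have h1 : ¬ (j : ℕ) < i := by omega
    have h2 : ¬ (j : ℕ) = i := by omega
    simp only [hw, contract, h1, h2, if_false]
    rw [← Fin.succ_castSucc j, ins_ge, ins_ge]
    · simp only [Fin.le_def, Fin.val_succ, Fin.val_castSucc]; omega
    · simp only [Fin.le_def, Fin.val_succ, Fin.val_castSucc]; omega

theorem Gam_unit {n : ℕ} (i : Fin (n + 1)) (M : Fin (n + 1) → Matrix ι ι B) (φ : MLM B (n + 1))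
    (c : Matrix ι ι ℂ) :
    (∑ k : Fin (n + 2) → ι, c (k (Fin.last (n + 1))) (k 0) *
        φ (Fin.insertNth i.succ 1 fun j => M j (k j.castSucc) (k j.succ) : Fin (n + 2) → B))
      = Gam (Fin.insertNth i.succ 1 M : Fin (n + 2) → Matrix ι ι B) φ c := by
  rw [Gam_apply, ← (Fin.insertNthEquiv (fun _ : Fin (n + 3) => ι) i.succ.succ).sum_comp,
    Fintype.sum_prod_type, Finset.sum_comm]
  refine Finset.sum_congr rfl fun k _ => ?_
  simp only [Fin.insertNthEquiv_apply]
  rw [Finset.sum_eq_single (k i.succ)]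
  · have a1 : ∀ q : Fin (n + 2), q ≤ i.succ →
        (Fin.insertNth i.succ.succ (k i.succ) k : Fin (n + 3) → ι) q.castSucc = k q := by
      intro q hq
      exact ins_lt _ _ _ _ (by simp only [Fin.le_def, Fin.lt_def, Fin.val_succ, Fin.val_castSucc] at *; omega)
    have a2 : ∀ q : Fin (n + 2), i.succ ≤ q →
        (Fin.insertNth i.succ.succ (k i.succ) k : Fin (n + 3) → ι) q.succ = k q := by
      intro q hq
      rcases eq_or_lt_of_le hq with h | h
      · subst h; rw [Fin.insertNth_apply_same]
      · exact ins_ge _ _ _ _ (by simp only [Fin.le_def, Fin.lt_def, Fin.val_succ, Fin.val_castSucc] at *; omega)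
    have e0 : (Fin.insertNth i.succ.succ (k i.succ) k : Fin (n + 3) → ι) 0 = k 0 :=
      a1 0 (Fin.zero_le _)
    have e1 : (Fin.insertNth i.succ.succ (k i.succ) k : Fin (n + 3) → ι) (Fin.last (n + 2))
        = k (Fin.last (n + 1)) := a2 (Fin.last (n + 1)) (Fin.le_last _)
    rw [e0, e1]
    congr 2
    ext q
    refine Fin.succAboveCases i.succ ?_ (fun j => ?_) q
    · rw [Fin.insertNth_apply_same, Fin.insertNth_apply_same, a1 _ le_rfl, a2 _ le_rfl,
        Matrix.one_apply_eq]
    · rw [Fin.insertNth_apply_succAbove, Fin.insertNth_apply_succAbove]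
      by_cases h : j.castSucc < i.succ
      · rw [Fin.succAbove_of_castSucc_lt _ _ h, Fin.succ_castSucc, a1 _ h.le, a1]
        simp only [Fin.le_def, Fin.lt_def, Fin.val_succ, Fin.val_castSucc] at *; omega
      · have h := not_lt.1 h
        rw [Fin.succAbove_of_le_castSucc _ _ h, ← Fin.succ_castSucc, a2 _ h, a2]
        simp only [Fin.le_def, Fin.val_succ, Fin.val_castSucc] at *; omega
  · intro x _ hx
    rw [φ.map_coord_zero i.succ, mul_zero]
    rw [Fin.insertNth_apply_same, Fin.insertNth_apply_same,
      ins_lt _ _ _ _ (by simp [Fin.lt_def]), Matrix.one_apply_ne (Ne.symm hx)]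
  · simp

theorem Psi_contract {n : ℕ} (f : Raw H B n) (hf : IsML f) (i : Fin (n + 1)) :
    PsiRaw D P (fun ω b => f ω (contract i b)) = fun ω M => PsiRaw D P f ω (contract i M) := by
  ext ω M
  exact sd_congr D ω fun x y => Gam_contract i M (toMLM f hf x) (P.π (D.Sinv y))

theorem Psi_s {n : ℕ} (f : Raw H B (n + 1)) (hf : IsML f) (i : Fin (n + 1)) :
    PsiRaw D P (sRaw i f) = sRaw i (PsiRaw D P f) := by
  ext ω M
  exact sd_congr D ω fun x y => Gam_unit i M (toMLM f hf x) (P.π (D.Sinv y))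

theorem contract_upd0 {n : ℕ} (b : Fin (n + 2) → B) (x : B) :
    contract (0 : Fin (n + 1)) (Function.update b 0 x)
      = Function.update (contract 0 b) 0 (x * b 1) := by
  ext j
  refine Fin.cases ?_ (fun j => ?_) j
  · simp [contract]
  · simp [contract]

theorem contract_upd1 {n : ℕ} (b : Fin (n + 2) → B) (x : B) :
    contract (0 : Fin (n + 1)) (Function.update b 1 x)
      = Function.update (contract 0 b) 0 (b 0 * x) := by
  ext j
  refine Fin.cases ?_ (fun j => ?_) j
  · simp [contract]
  · have : j.succ.succ ≠ 1 := by simp [Fin.ext_iff]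
    simp [contract, this]

theorem contract_upd2 {n : ℕ} (b : Fin (n + 2) → B) (i : Fin n) (x : B) :
    contract (0 : Fin (n + 1)) (Function.update b i.succ.succ x)
      = Function.update (contract 0 b) i.succ x := by
  ext j
  refine Fin.cases ?_ (fun j => ?_) j
  · have h0 : (0 : Fin (n + 2)) ≠ i.succ.succ := by simp [Fin.ext_iff]
    have h1 : (1 : Fin (n + 2)) ≠ i.succ.succ := by simp [Fin.ext_iff]
    have h2 : (0 : Fin (n + 1)) ≠ i.succ := by simp [Fin.ext_iff]
    simp [contract, h0, h1, h2]
  · by_cases h : j = i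
    · subst h; simp [contract]
    · simp [contract, h]

theorem ML_contract0 {n : ℕ} (f : Raw H B n) (hf : IsML f) :
    IsML (fun ω b => f ω (contract 0 b) : Raw H B (n + 1)) := by
  obtain ⟨h1, h2, h3, h4⟩ := hf
  refine ⟨fun ω η b => h1 _ _ _, fun c ω b => h2 _ _ _, ?_, ?_⟩
  · intro ω b i x y
    refine Fin.cases ?_ (fun i => Fin.cases ?_ (fun i => ?_) i) i
    · simp only [contract_upd0, add_mul, h3]
    · simp only [Fin.succ_zero_eq_one, contract_upd1, mul_add, h3]
    · simp only [contract_upd2, h3]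
  · intro ω b i c x
    refine Fin.cases ?_ (fun i => Fin.cases ?_ (fun i => ?_) i) i
    · simp only [contract_upd0, smul_mul_assoc, h4]
    · simp only [Fin.succ_zero_eq_one, contract_upd1, mul_smul_comm, h4]
    · simp only [contract_upd2, h4]

theorem Psi_d {n : ℕ} (f : Raw H B n) (hf : IsML f) (i : Fin (n + 2)) :
    PsiRaw D P (dRaw D A.fn i f) = dRaw D (matAct D P A) i (PsiRaw D P f) := by
  unfold dRaw
  by_cases h : (i : ℕ) < n + 1
  · simp only [h, dif_pos]
    exact Psi_contract D P f hf _
  · simp only [h, dif_neg, not_false_eq_true]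
    rw [Psi_t D P A _ (ML_contract0 f hf), Psi_contract D P f hf]

theorem Psi_add {n : ℕ} (f g : Raw H B n) :
    PsiRaw D P (f + g) = PsiRaw D P f + PsiRaw D P g := by
  ext ω M
  simp only [PsiRaw, Pi.add_apply, mul_add, Finset.sum_add_distrib, List.sum_map_add]

theorem Psi_smul {n : ℕ} (c : ℂ) (f : Raw H B n) :
    PsiRaw D P (c • f) = c • PsiRaw D P f := by
  ext ω M
  simp only [PsiRaw, Pi.smul_apply, smul_eq_mul, ← List.sum_map_mul_left, Finset.mul_sum,
    mul_left_comm c]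

end Simp


/-- for a finite-dimensional right `H`-module `X`, the maps `Ψⁿ` are
well defined linear maps `C^n_H(B) → C^n_H(End(X) ⊗ B)` and commute with the
operators `tₙ`, `dⁿᵢ`, `sⁿᵢ`, i.e. constitute a morphism of cocyclic objects (hence
they induce homomorphisms `HC^n_H(B) → HC^n_H(End(X) ⊗ B)`). -/
theorem Psi_is_cocyclic_morphism
    {H : Type} [Ring H] [HopfAlgebra ℂ H] (D : HopfData H)
    {B : Type} [Ring B] [Algebra ℂ B] (A : MAlg D B)
    (ι : Type) [Fintype ι] [DecidableEq ι] (P : MRep H ι) :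
    -- Ψ is linear
    (∀ (n : ℕ) (f g : Raw H B n),
      PsiRaw D P (f + g) = PsiRaw D P f + PsiRaw D P g) ∧
    (∀ (n : ℕ) (c : ℂ) (f : Raw H B n),
      PsiRaw D P (c • f) = c • PsiRaw D P f) ∧
    -- Ψ maps equivariant cochains to equivariant cochains
    (∀ (n : ℕ) (f : Raw H B n), InC D A.fn f →
      InC D (matAct D P A.toRAct) (PsiRaw D P f)) ∧
    -- Ψ commutes with the cyclic operator, the cofaces and the codegeneracies
    (∀ (n : ℕ) (f : Raw H B n), InC D A.fn f →
      PsiRaw D P (tRaw D A.fn f) = tRaw D (matAct D P A.toRAct) (PsiRaw D P f)) ∧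
    (∀ (n : ℕ) (f : Raw H B n), InC D A.fn f → ∀ i : Fin (n + 2),
      PsiRaw D P (dRaw D A.fn i f) = dRaw D (matAct D P A.toRAct) i (PsiRaw D P f)) ∧
    (∀ (n : ℕ) (f : Raw H B (n + 1)), InC D A.fn f → ∀ i : Fin (n + 1),
      PsiRaw D P (sRaw i f) = sRaw i (PsiRaw D P f)) := by
  refine ⟨fun n f g => Psi_add D P f g, fun n c f => Psi_smul D P c f,
    fun n f h => ⟨Psi_ML D P f h.1, Psi_Inv D P A.toRAct f h.1 h.2⟩,
    fun n f h => Psi_t D P A.toRAct f h.1,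
    fun n f h i => Psi_d D P A.toRAct f h.1 i,
    fun n f h i => Psi_s D P f h.1 i⟩

end
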